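/- Let R be a commutative ring and let x, y ∈ R satisfy: x has additive order exactly 8, y has additive order exactly 4, ℤ·x ∩ ℤ·y = 0 (so the additive subgroup K = ℤ·x + ℤ·y is isomorphic to ℤ/8 ⊕ ℤ/4), x² = 0, y² = 2y + 2ℓx for a fixed integer ℓ, and x·y = 4εx for a fixed integer ε. Then every element z ∈ K satisfies z⁴ = 0 (in particular every element of K is nilpotent), every element of the set 1 + K = {1 + z : z ∈ K} is a unit of R, and 1 + K is a subgroup of the unit group Rˣ of order 32. -/

import Mathlib

/-- If an additive subgroup `K` of a commutative ring is closed under multiplication and every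
element of `K` has fourth power zero, then `1 + K` is a subgroup of the group of units, in
bijection with `K`. -/
theorem exists_subgroup_units_eq_one_add {R : Type*} [CommRing R] (K : AddSubgroup R)
    (hmul : ∀ z ∈ K, ∀ w ∈ K, z * w ∈ K) (hnil : ∀ z ∈ K, z ^ 4 = 0) :
    ∃ H : Subgroup Rˣ,
      Units.val '' (H : Set Rˣ) = (fun z => 1 + z) '' (K : Set R) ∧ Nat.card H = Nat.card K := by
  let H : Subgroup Rˣ :=
    { carrier := {u | (u : R) - 1 ∈ K}
      one_mem' := by simp
      mul_mem' := fun {u v} hu hv => by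
        have h := K.add_mem (K.add_mem (hmul _ hu _ hv) hu) hv
        simp only [Set.mem_ofPred_eq, Units.val_mul]
        convert h using 1
        ring
      inv_mem' := fun {u} hu => by
        have hu' : (u : R) - 1 ∈ K := hu
        obtain ⟨z, hz⟩ : ∃ z, z = (u : R) - 1 := ⟨_, rfl⟩
        rw [← hz] at hu'
        have hzz := hmul _ hu' _ hu'
        have hinv : ((u⁻¹ : Rˣ) : R) = 1 - z + z * z - z * z * z := by
          rw [Units.inv_eq_of_mul_eq_one_right]
          have hval : (u : R) = 1 + z := by rw [hz]; ring
          rw [hval]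
          linear_combination -hnil z hu'
        have h := K.sub_mem (K.sub_mem hzz hu') (hmul _ hzz _ hu')
        simp only [Set.mem_ofPred_eq, hinv]
        convert h using 1
        ring }
  have himage : Units.val '' (H : Set Rˣ) = (fun z => 1 + z) '' (K : Set R) := by
    ext r
    constructor
    · rintro ⟨u, hu, rfl⟩
      exact ⟨(u : R) - 1, hu, by ring⟩
    · rintro ⟨z, hz, rfl⟩
      have hunit : IsUnit (1 + z) := IsNilpotent.isUnit_one_add ⟨4, hnil z hz⟩
      refine ⟨hunit.unit, ?_, rfl⟩
      change (1 + z) - 1 ∈ K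
      simpa using hz
  refine ⟨H, himage, ?_⟩
  calc Nat.card H = Nat.card (Units.val '' (H : Set Rˣ)) :=
        (Nat.card_image_of_injective Units.val_injective _).symm
    _ = Nat.card ((fun z => 1 + z) '' (K : Set R)) := by rw [himage]
    _ = Nat.card K := Nat.card_image_of_injective (add_right_injective 1) _

/-- The subgroup generated by two elements whose cyclic subgroups meet trivially has order the
product of the orders of the elements. -/
theorem card_closure_pair {A : Type*} [AddCommGroup A] (x y : A)
    (hxy : ∀ a b : ℤ, a • x = b • y → a • x = 0) :
    Nat.card (AddSubgroup.closure ({x, y} : Set A)) = addOrderOf x * addOrderOf y := by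
  rw [← Nat.card_zmultiples, ← Nat.card_zmultiples, ← Nat.card_prod]
  let f : AddSubgroup.zmultiples x × AddSubgroup.zmultiples y → A := fun p => p.1 + p.2
  have hf : Function.Injective f := by
    rintro ⟨⟨_, a, rfl⟩, ⟨_, b, rfl⟩⟩ ⟨⟨_, c, rfl⟩, ⟨_, d, rfl⟩⟩ h
    have h' : a • x + b • y = c • x + d • y := h
    have hsub : (a - c) • x = (d - b) • y := by
      rw [sub_smul, sub_smul, sub_eq_sub_iff_add_eq_add, h', add_comm]
    have hx := hxy _ _ hsub
    have hy : (d - b) • y = 0 := hsub ▸ hx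
    rw [sub_smul, sub_eq_zero] at hx hy
    simp [hx, hy]
  have hrange : Set.range f = (AddSubgroup.closure ({x, y} : Set A) : Set A) := by
    ext z
    simp only [Set.mem_range, SetLike.mem_coe, AddSubgroup.mem_closure_pair]
    constructor
    · rintro ⟨⟨⟨_, a, rfl⟩, ⟨_, b, rfl⟩⟩, rfl⟩
      exact ⟨a, b, rfl⟩
    · rintro ⟨a, b, rfl⟩
      exact ⟨⟨⟨_, a, rfl⟩, ⟨_, b, rfl⟩⟩, rfl⟩
  have hcard := Nat.card_range_of_injective hf
  rw [hrange] at hcard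
  exact hcard

/-- Let `R` be a commutative ring, `x, y ∈ R` with additive orders exactly 8 and 4,
with `ℤ·x ∩ ℤ·y = 0`, `x² = 0`, `y² = 2y + 2ℓx`, and `x·y = 4εx`.  Then every element of the
additive subgroup `K` generated by `x` and `y` has fourth power zero (hence is nilpotent),
every element of `1 + K` is a unit, and `1 + K` is a subgroup of `Rˣ` of order 32. -/
theorem stmt_0 {R : Type*} [CommRing R] (x y : R) (ℓ ε : ℤ)
    (hx8 : addOrderOf x = 8) (hy4 : addOrderOf y = 4)
    (hint : ∀ a b : ℤ, a • x = b • y → a • x = 0)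
    (hx2 : x ^ 2 = 0) (hy2 : y ^ 2 = 2 * y + (2 * ℓ) • x)
    (hxy : x * y = (4 * ε) • x) :
    (∀ z ∈ AddSubgroup.closure ({x, y} : Set R), z ^ 4 = 0) ∧
    (∀ z ∈ AddSubgroup.closure ({x, y} : Set R), IsUnit (1 + z)) ∧
    ∃ H : Subgroup Rˣ,
      Units.val '' (H : Set Rˣ) =
        (fun z => 1 + z) '' ((AddSubgroup.closure ({x, y} : Set R) : AddSubgroup R) : Set R) ∧
      Nat.card H = 32 := by
  have hx : (8 : R) * x = 0 := by
    simpa [hx8, nsmul_eq_mul] using addOrderOf_nsmul_eq_zero x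
  have hy : (4 : R) * y = 0 := by
    simpa [hy4, nsmul_eq_mul] using addOrderOf_nsmul_eq_zero y
  have hmul : ∀ z ∈ AddSubgroup.closure ({x, y} : Set R),
      ∀ w ∈ AddSubgroup.closure ({x, y} : Set R),
        z * w ∈ AddSubgroup.closure ({x, y} : Set R) := by
    intro z hz w hw
    obtain ⟨a, b, rfl⟩ := AddSubgroup.mem_closure_pair.1 hz
    obtain ⟨c, d, rfl⟩ := AddSubgroup.mem_closure_pair.1 hw
    refine AddSubgroup.mem_closure_pair.2
      ⟨4 * ε * (a * d + b * c) + 2 * ℓ * (b * d), 2 * (b * d), ?_⟩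
    simp only [zsmul_eq_mul] at hy2 hxy ⊢
    push_cast at hy2 hxy ⊢
    linear_combination -(a * c : R) * hx2 - (b * d : R) * hy2 - (a * d + b * c : R) * hxy
  have hnil : ∀ z ∈ AddSubgroup.closure ({x, y} : Set R), z ^ 4 = 0 := by
    intro z hz
    obtain ⟨a, b, rfl⟩ := AddSubgroup.mem_closure_pair.1 hz
    simp only [zsmul_eq_mul] at hy2 hxy ⊢
    push_cast at hy2 hxy ⊢
    have hsq : ((a : R) * x + b * y) ^ 2 = 2 * b ^ 2 * (y + ℓ * x) := by
      linear_combination (a ^ 2 : R) * hx2 + (b ^ 2 : R) * hy2 + (2 * a * b : R) * hxy +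
        (a * b * ε : R) * hx
    have hsq' : 4 * (y + (ℓ : R) * x) ^ 2 = 0 := by
      linear_combination (4 * ℓ ^ 2 : R) * hx2 + 4 * hy2 + (8 * ℓ : R) * hxy +
        2 * hy + (ℓ + 4 * ℓ * ε : R) * hx
    linear_combination (((a : R) * x + b * y) ^ 2 + 2 * b ^ 2 * (y + ℓ * x)) * hsq +
      (b ^ 4 : R) * hsq'
  refine ⟨hnil, fun z hz => IsNilpotent.isUnit_one_add ⟨4, hnil z hz⟩, ?_⟩
  obtain ⟨H, himage, hcard⟩ := exists_subgroup_units_eq_one_add _ hmul hnil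
  exact ⟨H, himage, by rw [hcard, card_closure_pair x y hint, hx8, hy4]⟩
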